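/- Let m and n be integers with m, n ≥ 2. Then 𝒦_{m,n} admits a C₄-face-magic Klein bottle labeling if and only if n is even. -/

import Mathlib

/-- Reduction of a (positive) index modulo `n` to a representative in `{1, …, n}`. -/
def wrap (n j : ℕ) : ℕ := if j % n = 0 then n else j % n

/-- `x` is a C₄-face-magic Klein bottle labeling of the `m × n` Klein bottle grid graph
`𝒦_{m,n}` with C₄-face-magic value `S`: `x` is a bijection from `{1,…,m} × {1,…,n}`
onto `{1,…,m*n}` and every C₄-face of the natural embedding of `𝒦_{m,n}` in the Klein
bottle has vertex-label sum `S`. -/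
def IsC4FaceMagic (m n : ℕ) (x : ℕ × ℕ → ℕ) (S : ℕ) : Prop :=
  Set.BijOn x (Set.Icc 1 m ×ˢ Set.Icc 1 n) (Set.Icc 1 (m * n)) ∧
  (∀ i j, 1 ≤ i → i + 1 ≤ m → 1 ≤ j → j ≤ n →
    x (i, j) + x (i + 1, j) + x (i, wrap n (j + 1)) + x (i + 1, wrap n (j + 1)) = S) ∧
  (∀ j, 1 ≤ j → j ≤ n →
    x (m, j) + x (m, wrap n (j + 1)) + x (1, n + 1 - j) + x (1, wrap n (n - j)) = S)

lemma wrap_succ_of_lt {n j : ℕ} (h : j < n) : wrap n (j + 1) = j + 1 := by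
  unfold wrap
  rcases Nat.lt_or_ge (j + 1) n with h' | h'
  · simp [Nat.mod_eq_of_lt h']
  · obtain rfl : j + 1 = n := by omega
    simp

lemma wrap_succ_self {n : ℕ} (h : 2 ≤ n) : wrap n (n + 1) = 1 := by
  simp [wrap, Nat.mod_eq_of_lt (show 1 < n by omega)]

lemma wrap_sub {n j : ℕ} (hn : 2 ≤ n) (h1 : 1 ≤ j) (h2 : j ≤ n) :
    wrap n (n - j) = n + 1 - wrap n (j + 1) := by
  rcases h2.lt_or_eq with h | rfl
  · rw [wrap_succ_of_lt h]
    have : n - j < n := by omega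
    simp only [wrap, Nat.mod_eq_of_lt this]
    split_ifs <;> omega
  · rw [wrap_succ_self hn]
    simp [wrap]

/-- A cyclic sequence of odd length whose consecutive sums are all equal to `S` is constant,
with value `S / 2`. -/
lemma two_mul_eq_of_cyclic_add_eq {n S : ℕ} {r : ℕ → ℕ} (hn : 2 ≤ n) (hodd : ¬ Even n)
    (h : ∀ j, 1 ≤ j → j ≤ n → r j + r (wrap n (j + 1)) = S) {j : ℕ} (h1 : 1 ≤ j) (h2 : j ≤ n) :
    2 * r j = S := by
  have key : ∀ k < n, (Even k → r (k + 1) = r 1) ∧ (¬ Even k → r (k + 1) + r 1 = S) := by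
    intro k
    induction k with
    | zero => simp
    | succ k ih =>
      intro hk
      have h' := h (k + 1) (by omega) (by omega)
      rw [wrap_succ_of_lt hk] at h'
      obtain ⟨ih₁, ih₂⟩ := ih (by omega)
      rw [Nat.even_add_one, not_not]
      exact ⟨fun hk => by have := ih₂ hk; omega, fun hk => by have := ih₁ hk; omega⟩
  have hlast := h n (by omega) le_rfl
  rw [wrap_succ_self hn] at hlast
  have hn1 := (key (n - 1) (by omega)).1 (by rw [Nat.even_iff] at hodd ⊢; omega)
  rw [Nat.sub_add_cancel (by omega)] at hn1
  obtain ⟨ke, ko⟩ := key (j - 1) (by omega)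
  rw [Nat.sub_add_cancel h1] at ke ko
  by_cases he : Even (j - 1)
  · have := ke he
    omega
  · have := ko he
    omega

lemma IsC4FaceMagic.even {m n : ℕ} (hm : 2 ≤ m) (hn : 2 ≤ n) {x : ℕ × ℕ → ℕ} {S : ℕ}
    (hx : IsC4FaceMagic m n x S) : Even n := by
  by_contra hodd
  obtain ⟨hbij, hface, hclose⟩ := hx
  have hcol : ∀ i j, 1 ≤ i → i + 1 ≤ m → 1 ≤ j → j ≤ n →
      2 * (x (i, j) + x (i + 1, j)) = S := fun i j hi hi' hj hj' =>
    two_mul_eq_of_cyclic_add_eq (r := fun j => x (i, j) + x (i + 1, j)) hn hodd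
      (fun j h1 h2 => by have := hface i j hi hi' h1 h2; omega) hj hj'
  have hends : ∀ j, 1 ≤ j → j ≤ n → 2 * (x (m, j) + x (1, n + 1 - j)) = S := fun j hj hj' =>
    two_mul_eq_of_cyclic_add_eq (r := fun j => x (m, j) + x (1, n + 1 - j)) hn hodd
      (fun j h1 h2 => by
        have := hclose j h1 h2
        rw [wrap_sub hn h1 h2] at this
        omega) hj hj'
  have inj : ∀ {i j i' j' : ℕ}, 1 ≤ i → i ≤ m → 1 ≤ j → j ≤ n → 1 ≤ i' → i' ≤ m → 1 ≤ j' →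
      j' ≤ n → x (i, j) = x (i', j') → i = i' ∧ j = j' := by
    intro i j i' j' h1 h2 h3 h4 h5 h6 h7 h8 he
    simpa using hbij.injOn (Set.mk_mem_prod ⟨h1, h2⟩ ⟨h3, h4⟩)
      (Set.mk_mem_prod ⟨h5, h6⟩ ⟨h7, h8⟩) he
  rcases hm.eq_or_lt with rfl | hm3
  · have h1 := hcol 1 1 le_rfl (by omega) le_rfl (by omega)
    have h2 := hends 1 le_rfl (by omega)
    have := inj (i := 1) (j := 1) (i' := 1) (j' := n + 1 - 1) le_rfl (by omega) le_rfl (by omega)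
      le_rfl (by omega) (by omega) (by omega) (by simp only [Nat.reduceAdd] at h1; omega)
    omega
  · have h1 := hcol 1 1 le_rfl (by omega) le_rfl (by omega)
    have h2 := hcol 2 1 (by omega) (by omega) le_rfl (by omega)
    have := inj (i := 1) (j := 1) (i' := 3) (j' := 1) le_rfl (by omega) le_rfl (by omega)
      (by omega) (by omega) le_rfl (by omega)
      (by simp only [Nat.reduceAdd] at h1 h2; omega)
    omega

lemma Set.BijOn.of_mapsTo_injOn_Icc {m n : ℕ} {x : ℕ × ℕ → ℕ}
    (hmaps : Set.MapsTo x (Set.Icc 1 m ×ˢ Set.Icc 1 n) (Set.Icc 1 (m * n)))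
    (hinj : Set.InjOn x (Set.Icc 1 m ×ˢ Set.Icc 1 n)) :
    Set.BijOn x (Set.Icc 1 m ×ˢ Set.Icc 1 n) (Set.Icc 1 (m * n)) := by
  refine ⟨hmaps, hinj, ?_⟩
  have hs : ((Finset.Icc 1 m ×ˢ Finset.Icc 1 n : Finset (ℕ × ℕ)) : Set (ℕ × ℕ)) =
      Set.Icc 1 m ×ˢ Set.Icc 1 n := by simp
  have ht : ((Finset.Icc 1 (m * n) : Finset ℕ) : Set ℕ) = Set.Icc 1 (m * n) := by simp
  rw [← hs, ← ht] at hmaps ⊢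
  rw [← hs] at hinj
  exact Finset.surjOn_of_injOn_of_card_le x hmaps hinj (by simp)

/-- The checkerboard labeling built from a column index `k`: the cell `(i, j)` receives
`m * k j + i` if `i + j` is even, and the complement of this number in `m * n + 1` otherwise. -/
def checkerboardLabel (m n : ℕ) (k : ℕ → ℕ) (p : ℕ × ℕ) : ℕ :=
  if Even (p.1 + p.2) then m * k p.2 + p.1 else m * n + 1 - (m * k p.2 + p.1)

lemma mul_add_le_mul {m n a i : ℕ} (ha : a < n) (hi : i ≤ m) : m * a + i ≤ m * n := by
  have := Nat.mul_le_mul_left m (Nat.succ_le_of_lt ha)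
  rw [Nat.mul_succ] at this
  omega

lemma mul_add_inj {m a b i j : ℕ} (hi : 1 ≤ i) (hi' : i ≤ m) (hj : 1 ≤ j) (hj' : j ≤ m)
    (h : m * a + i = m * b + j) : a = b ∧ i = j := by
  rcases lt_trichotomy a b with hab | rfl | hab
  · have := mul_add_le_mul hab hi'
    omega
  · exact ⟨rfl, by omega⟩
  · have := mul_add_le_mul hab hj'
    omega

/-- The checkerboard labeling is magic as soon as it does not repeat a label and its columns
`j` and `n + 1 - j` are compatible. -/
lemma isC4FaceMagic_checkerboardLabel {m n : ℕ} {k : ℕ → ℕ} (hn : 2 ≤ n) (he : Even n)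
    (hk : ∀ j, 1 ≤ j → j ≤ n → k j < n)
    (hsame : ∀ i j j', 1 ≤ j → j ≤ n → 1 ≤ j' → j' ≤ n → Even (i + j) → Even (i + j') →
      k j = k j' → j = j')
    (hsame' : ∀ i j j', 1 ≤ j → j ≤ n → 1 ≤ j' → j' ≤ n → ¬ Even (i + j) → ¬ Even (i + j') →
      k j = k j' → j = j')
    (hdiff : ∀ i j i' j', 1 ≤ i → i ≤ m → 1 ≤ j → j ≤ n → 1 ≤ i' → i' ≤ m → 1 ≤ j' → j' ≤ n →
      Even (i + j) → ¬ Even (i' + j') → m * k j + i + (m * k j' + i') ≠ m * n + 1)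
    {c d : ℕ} (hcd : c + d = 2 * (m * n + 1))
    (hends : ∀ j, 1 ≤ j → j ≤ n →
      checkerboardLabel m n k (m, j) + checkerboardLabel m n k (1, n + 1 - j) =
        if Even j then c else d) :
    IsC4FaceMagic m n (checkerboardLabel m n k) (2 * (m * n + 1)) := by
  have hpar : ∀ j, 1 ≤ j → j ≤ n →
      (1 ≤ wrap n (j + 1) ∧ wrap n (j + 1) ≤ n) ∧ (Even (wrap n (j + 1)) ↔ ¬ Even j) := by
    intro j h1 h2
    rcases h2.lt_or_eq with h | rfl
    · rw [wrap_succ_of_lt h, Nat.even_add_one]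
      exact ⟨by omega, Iff.rfl⟩
    · rw [wrap_succ_self hn]
      exact ⟨by omega, by simp [he]⟩
  have hcol : ∀ i j, 1 ≤ i → i + 1 ≤ m → 1 ≤ j → j ≤ n →
      checkerboardLabel m n k (i, j) + checkerboardLabel m n k (i + 1, j) =
        if Even (i + j) then m * n else m * n + 2 := by
    intro i j h1 h2 h3 h4
    have hle := mul_add_le_mul (hk j h3 h4) h2
    have hp : Even (i + 1 + j) ↔ ¬ Even (i + j) := by
      rw [add_right_comm, Nat.even_add_one]
    simp only [checkerboardLabel, hp]
    split_ifs <;> omega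
  refine ⟨Set.BijOn.of_mapsTo_injOn_Icc ?_ ?_, ?_, ?_⟩
  · rintro ⟨i, j⟩ ⟨⟨h1, h2⟩, h3, h4⟩
    have hle := mul_add_le_mul (hk j h3 h4) h2
    simp only [checkerboardLabel, Set.mem_Icc] at *
    split_ifs <;> omega
  · rintro ⟨i, j⟩ ⟨⟨h1, h2⟩, h3, h4⟩ ⟨i', j'⟩ ⟨⟨h5, h6⟩, h7, h8⟩ heq
    dsimp only at h1 h2 h3 h4 h5 h6 h7 h8
    have hle := mul_add_le_mul (hk j h3 h4) h2
    have hle' := mul_add_le_mul (hk j' h7 h8) h6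
    simp only [checkerboardLabel] at heq
    split_ifs at heq with hp hp' hp'
    · obtain ⟨hkk, rfl⟩ := mul_add_inj h1 h2 h5 h6 heq
      rw [hsame i j j' h3 h4 h7 h8 hp hp' hkk]
    · exact absurd (by omega) (hdiff i j i' j' h1 h2 h3 h4 h5 h6 h7 h8 hp hp')
    · exact absurd (by omega) (hdiff i' j' i j h5 h6 h7 h8 h1 h2 h3 h4 hp' hp)
    · obtain ⟨hkk, rfl⟩ := mul_add_inj (a := k j) (b := k j') h1 h2 h5 h6 (by omega)
      rw [hsame' i j j' h3 h4 h7 h8 hp hp' hkk]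
  · intro i j h1 h2 h3 h4
    obtain ⟨⟨h5, h6⟩, hw⟩ := hpar j h3 h4
    have e1 := hcol i j h1 h2 h3 h4
    have e2 := hcol i _ h1 h2 h5 h6
    have hp : Even (i + wrap n (j + 1)) ↔ ¬ Even (i + j) := by
      rw [Nat.even_add, Nat.even_add, hw]
      tauto
    simp only [hp] at e2
    split_ifs at e1 e2 <;> omega
  · intro j h3 h4
    obtain ⟨⟨h5, h6⟩, hw⟩ := hpar j h3 h4
    have e1 := hends j h3 h4
    have e2 := hends _ h5 h6
    rw [wrap_sub hn h3 h4]
    simp only [hw] at e2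
    split_ifs at e1 e2 <;> omega

lemma isC4FaceMagic_of_even_of_even {m n : ℕ} (hm : 2 ≤ m) (hn : 2 ≤ n) (hme : Even m)
    (he : Even n) :
    IsC4FaceMagic m n (checkerboardLabel m n fun j => j - 1) (2 * (m * n + 1)) := by
  refine isC4FaceMagic_checkerboardLabel (c := m * n + 1) (d := m * n + 1) hn he
    (fun j _ _ => by omega) (fun i j j' _ _ _ _ _ _ _ => by omega)
    (fun i j j' _ _ _ _ _ _ _ => by omega) ?_ (by ring) ?_
  · intro i j i' j' h1 h2 h3 h4 h5 h6 h7 h8 hp hp' h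
    obtain ⟨hk, hi⟩ := mul_add_inj (m := m) (a := j - 1) (b := n - j') (i := i) (j := m + 1 - i')
      h1 h2 (by omega) (by omega) (by
        have : m * n = m * (j' - 1) + m * (n - j') + m := by
          rw [← Nat.mul_add, ← Nat.mul_succ]
          congr 1
          omega
        omega)
    rw [Nat.even_iff] at *
    omega
  · intro j h1 h2
    have hle := mul_add_le_mul (m := m) (a := j - 1) (n := n) (i := m) (by omega) le_rfl
    have hsum : m * n = m * (j - 1) + m * (n - j) + m := by
      rw [← Nat.mul_add, ← Nat.mul_succ]
      congr 1
      omega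
    have hp : Even (m + j) ↔ Even j := by simp [Nat.even_add, hme]
    have hp' : Even (1 + (n + 1 - j)) ↔ Even j := by
      rw [Nat.even_iff] at he
      rw [Nat.even_iff, Nat.even_iff]
      omega
    have hs : n + 1 - j - 1 = n - j := by omega
    simp only [checkerboardLabel, hp, hp', hs]
    split_ifs <;> omega

lemma isC4FaceMagic_of_odd_of_even {m n : ℕ} (hn : 2 ≤ n) (hmo : ¬ Even m) (he : Even n) :
    IsC4FaceMagic m n (checkerboardLabel m n fun j => min (j - 1) (n - j)) (2 * (m * n + 1)) := by
  obtain ⟨h, rfl⟩ := he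
  refine isC4FaceMagic_checkerboardLabel (c := m * (h + h) + 1 - (m - 1))
    (d := m * (h + h) + 1 + (m - 1)) hn ⟨h, rfl⟩ (fun j _ _ => by omega) ?_ ?_ ?_ ?_ ?_
  · intro i j j' _ _ _ _ hp hp' _
    rw [Nat.even_iff] at hp hp'
    omega
  · intro i j j' _ _ _ _ hp hp' _
    rw [Nat.even_iff] at hp hp'
    omega
  · intro i j i' j' h1 h2 h3 h4 h5 h6 h7 h8 hp hp'
    have hle := mul_add_le_mul (m := m) (a := min (j - 1) (h + h - j)) (n := h) (by omega) h2
    have hle' := mul_add_le_mul (m := m) (a := min (j' - 1) (h + h - j')) (n := h) (by omega) h6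
    rw [Nat.mul_add]
    omega
  · have := Nat.le_mul_of_pos_right m (show 0 < h + h by omega)
    omega
  · intro j h1 h2
    have hm : 1 ≤ m := Nat.one_le_iff_ne_zero.2 (by rintro rfl; simp at hmo)
    have hle := mul_add_le_mul (m := m) (a := min (j - 1) (h + h - j)) (n := h + h) (i := m)
      (by omega) le_rfl
    have hp : Even (m + j) ↔ ¬ Even j := by simp [Nat.even_add, hmo]
    have hp' : Even (1 + (h + h + 1 - j)) ↔ Even j := by
      rw [Nat.even_iff, Nat.even_iff]
      omega
    have hs : min (h + h + 1 - j - 1) (h + h - (h + h + 1 - j)) = min (j - 1) (h + h - j) := by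
      omega
    simp only [checkerboardLabel, hp, hp', hs]
    split_ifs <;> omega

/-- For `m, n ≥ 2`, `𝒦_{m,n}` admits a C₄-face-magic Klein bottle labeling
if and only if `n` is even. -/
theorem kleinBottle_magicLabeling_iff_even (m n : ℕ) (hm : 2 ≤ m) (hn : 2 ≤ n) :
    (∃ x S, IsC4FaceMagic m n x S) ↔ Even n := by
  refine ⟨fun ⟨x, S, hx⟩ => hx.even hm hn, fun he => ?_⟩
  by_cases hme : Even m
  · exact ⟨_, _, isC4FaceMagic_of_even_of_even hm hn hme he⟩
  · exact ⟨_, _, isC4FaceMagic_of_odd_of_even hn hme he⟩
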